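/- Let φ be a Sturmian coloring of a d-regular tree and let V ≠ S_n be a class of n-balls. Then for each n ≥ −1: (1) for every class U of n-balls with U ≠ S_n, C_n one has i(U,V) = i(Ū,V̄) and i(U,S_n) = i(Ū,A_{n+1}) + i(Ū,B_{n+1}); (2) if C_n ≠ S_n, then i(C_n,V) = i_A(S_{n+1},V̄), i(C_n,S_n) = i_A(S_{n+1},A_{n+1}) + i_A(S_{n+1},B_{n+1}), i_A(S_n,V) = i(A_{n+1},V̄), and i_A(S_n,S_n) = i(A_{n+1},A_{n+1}) + i(A_{n+1},B_{n+1}); (3) if C_n = S_n with S_{n+1} = A_{n+1}, then i_A(S_n,V) = i_A(A_{n+1},V̄) = i_B(A_{n+1},V̄), i_A(S_n,S_n) = i_A(A_{n+1},A_{n+1}) + i_A(A_{n+1},B_{n+1}) = i_B(A_{n+1},A_{n+1}) + i_B(A_{n+1},B_{n+1}), i_B(S_n,V) = i(B_{n+1},V̄), and i_B(S_n,S_n) = i(B_{n+1},A_{n+1}) + i(B_{n+1},B_{n+1}). Analogous identities hold with the roles of A and B exchanged. -/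

import Mathlib

open scoped Classical

noncomputable section

namespace Sturm

variable {V α : Type}

/-- `G` is a `d`-regular tree. -/
structure IsRegularTree (G : SimpleGraph V) (d : ℕ) : Prop where
  isTree : G.IsTree
  regular : ∀ v : V, (G.neighborSet v).ncard = d

/-- Color-preserving isomorphism of the `n`-balls centered at `x` and `y`,
sending center to center. -/
def BallEquiv (G : SimpleGraph V) (φ : V → α) (n : ℕ) (x y : V) : Prop :=
  ∃ f : {z : V // G.dist x z ≤ n} ≃ {z : V // G.dist y z ≤ n},
    (∀ u v : {z : V // G.dist x z ≤ n}, G.Adj u.1 v.1 ↔ G.Adj (f u).1 (f v).1) ∧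
    (∀ u : {z : V // G.dist x z ≤ n}, φ (f u).1 = φ u.1) ∧
    ((f ⟨x, by rw [SimpleGraph.dist_self]; exact Nat.zero_le n⟩).1 = y)

/-- The class of the `n`-ball at `x`, viewed as the set of all centers of equivalent balls. -/
def ballClass (G : SimpleGraph V) (φ : V → α) (n : ℕ) (x : V) : Set V :=
  {y | BallEquiv G φ n x y}

/-- The set `B_n(φ)` of classes of `n`-balls occurring in `(T, φ)`. -/
def ballClasses (G : SimpleGraph V) (φ : V → α) (n : ℕ) : Set (Set V) :=
  {C | ∃ x, C = ballClass G φ n x}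

/-- A coloring is Sturmian if its factor complexity is `n + 2`. -/
def IsSturmian (G : SimpleGraph V) (φ : V → α) : Prop :=
  ∀ n, (ballClasses G φ n).ncard = n + 2

/-- `x` is the center of a special `n`-ball. -/
def IsSpecialVert (G : SimpleGraph V) (φ : V → α) (n : ℕ) (x : V) : Prop :=
  ∃ y, BallEquiv G φ n x y ∧ ¬ BallEquiv G φ (n + 1) x y

/-- `S` is a special class of `n`-balls: the restriction of two distinct classes of
`(n+1)`-balls. -/
def IsSpecialClass (G : SimpleGraph V) (φ : V → α) (n : ℕ) (S : Set V) : Prop :=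
  ∃ x, S = ballClass G φ n x ∧ IsSpecialVert G φ n x

/-- The class `D` is always adjacent to the class `E`. -/
def AlwaysAdjTo (G : SimpleGraph V) (D E : Set V) : Prop :=
  ∀ x ∈ D, ∃ y, G.Adj x y ∧ y ∈ E

/-- The classes `D` and `E` are (always) adjacent. -/
def AlwaysAdj (G : SimpleGraph V) (D E : Set V) : Prop :=
  AlwaysAdjTo G D E ∧ AlwaysAdjTo G E D

/-- The classes `D` and `E` can be adjacent. -/
def CanAdj (G : SimpleGraph V) (D E : Set V) : Prop :=
  ∃ x ∈ D, ∃ y ∈ E, G.Adj x y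

/-- The number of neighbors of `x` lying in (i.e. being centers of balls of class) `E`. -/
def nbrCount (G : SimpleGraph V) (x : V) (E : Set V) : ℕ :=
  (G.neighborSet x ∩ E).ncard

/-- The data of the labels `S_n, C_n, A_n, B_n` for a Sturmian coloring, normalized as in
the paper: `S_0 = A_0 = [a]`, `B_0 = [b]`, `A_{n+1}` (resp. `B_{n+1}`) is always adjacent
to `A_n` (resp. `B_n`), and `A_{n+1}, B_{n+1}` are the two distinct extensions of `S_n`. -/
structure Labeling (G : SimpleGraph V) (φ : V → α) (a b : α) where
  S : ℕ → Set V
  C : ℕ → Set V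
  A : ℕ → Set V
  B : ℕ → Set V
  S_special : ∀ n, IsSpecialClass G φ n (S n)
  C_central : ∀ n, ∃ x, IsSpecialVert G φ (n + 1) x ∧ S (n + 1) = ballClass G φ (n + 1) x ∧
      C n = ballClass G φ n x
  A0_eq_S0 : A 0 = S 0
  A0_col : ∃ x, φ x = a ∧ A 0 = ballClass G φ 0 x
  B0_col : ∃ x, φ x = b ∧ B 0 = ballClass G φ 0 x
  A_ext : ∀ n, ∃ x, IsSpecialVert G φ n x ∧ S n = ballClass G φ n x ∧
      A (n + 1) = ballClass G φ (n + 1) x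
  B_ext : ∀ n, ∃ x, IsSpecialVert G φ n x ∧ S n = ballClass G φ n x ∧
      B (n + 1) = ballClass G φ (n + 1) x
  AB_ne : ∀ n, A (n + 1) ≠ B (n + 1)
  A_adj : ∀ n, AlwaysAdjTo G (A (n + 1)) (A n)
  B_adj : ∀ n, AlwaysAdjTo G (B (n + 1)) (B n)

/-- A cycle (of length `≥ 3`, with pairwise distinct vertices) in the graph `G_n` of
classes of `n`-balls, where classes are joined when they can be adjacent. -/
def IsCycleIn (G : SimpleGraph V) (φ : V → α) (n k : ℕ) (c : ℕ → Set V) : Prop :=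
  3 ≤ k ∧ (∀ i < k, c i ∈ ballClasses G φ n) ∧
    (∀ i < k, CanAdj G (c i) (c ((i + 1) % k))) ∧
    (∀ i < k, ∀ j < k, c i = c j → i = j)

/-- The graph `G_n` contains a cycle. -/
def HasCycle (G : SimpleGraph V) (φ : V → α) (n : ℕ) : Prop :=
  ∃ k c, IsCycleIn G φ n k c

/-! ## Edge-indexed colored graphs -/

/-- An edge-indexed graph, with vertices colored by `α` and labeled by classes
(sets of vertices of the underlying tree `V`). Index `0` means "no edge". -/
structure EIG (V α : Type) where
  Vert : Type
  idx : Vert → Vert → ℕ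
  col : Vert → α
  lab : Vert → Set V

/-- Isomorphism of colored edge-indexed graphs. -/
structure EIGIso (X Y : EIG V α) where
  e : X.Vert ≃ Y.Vert
  idx_eq : ∀ u v, Y.idx (e u) (e v) = X.idx u v
  col_eq : ∀ u, Y.col (e u) = X.col u

/-- The index `i_A(D, E)` (resp. `i_B`, `i`) at the level of classes: the number of
neighbors, in class `E`, of a representative center of `D`; when `D` is the special
class `Sp`, the representative is taken with extension of class `Ext`. -/
def classIdx (G : SimpleGraph V) (Sp Ext : Set V) (D E : Set V) : ℕ :=
  if D = Sp then (if h : Ext.Nonempty then nbrCount G h.some E else 0)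
  else (if h : D.Nonempty then nbrCount G h.some E else 0)

/-- The classes of `n`-balls joined to `Sp` by a path of edges of positive `J`-index. -/
def reachSet (G : SimpleGraph V) (φ : V → α) (n : ℕ) (Sp : Set V)
    (J : Set V → Set V → ℕ) : Set (Set V) :=
  {D | ∃ k, ∃ c : ℕ → Set V, c 0 = Sp ∧ c k = D ∧ (∀ i ≤ k, c i ∈ ballClasses G φ n) ∧
    ∀ i < k, 0 < J (c i) (c (i + 1)) ∨ 0 < J (c (i + 1)) (c i)}

/-- Color of a class: the color of (the center of) any of its representatives. -/
def colOf [Nonempty V] (φ : V → α) (D : Set V) : α :=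
  if h : D.Nonempty then φ h.some else φ (Classical.arbitrary V)

/-- The edge-indexed graph `G^A_n` (when `Ext = A_{n+1}`) resp. `G^B_n`. -/
def sideEIG [Nonempty V] (G : SimpleGraph V) (φ : V → α) (n : ℕ) (Sp Ext : Set V) :
    EIG V α where
  Vert := {D : Set V // D ∈ reachSet G φ n Sp (classIdx G Sp Ext)}
  idx := fun D E => classIdx G Sp Ext D.1 E.1
  col := fun D => colOf φ D.1
  lab := fun D => D.1

variable {G : SimpleGraph V} {φ : V → α} {a b : α}

/-- The edge-indexed graph `G^A_n`. -/
def GAeig [Nonempty V] (L : Labeling G φ a b) (n : ℕ) : EIG V α :=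
  sideEIG G φ n (L.S n) (L.A (n + 1))

/-- The edge-indexed graph `G^B_n`. -/
def GBeig [Nonempty V] (L : Labeling G φ a b) (n : ℕ) : EIG V α :=
  sideEIG G φ n (L.S n) (L.B (n + 1))

/-- Vertex set of `G^A_n`. -/
def VGAset (L : Labeling G φ a b) (n : ℕ) : Set (Set V) :=
  reachSet G φ n (L.S n) (classIdx G (L.S n) (L.A (n + 1)))

/-- Vertex set of `G^B_n`. -/
def VGBset (L : Labeling G φ a b) (n : ℕ) : Set (Set V) :=
  reachSet G φ n (L.S n) (classIdx G (L.S n) (L.B (n + 1)))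

/-- `G^A_n` or `G^B_n`, selected by a letter (`true = A`, `false = B`). -/
def GsideEIG [Nonempty V] (L : Labeling G φ a b) (n : ℕ) : Bool → EIG V α
  | true => GAeig L n
  | false => GBeig L n

/-- Vertex set of `G^A_n` or `G^B_n`, selected by a letter. -/
def VGside (L : Labeling G φ a b) (n : ℕ) : Bool → Set (Set V)
  | true => VGAset L n
  | false => VGBset L n

/-- A single vertex with a loop of index `d` (the graph `G^A_{-1} = G^B_{-1} = F^._{-1}`). -/
def baseEIG (V : Type) (x : α) (d : ℕ) : EIG V α where
  Vert := PUnit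
  idx := fun _ _ => d
  col := fun _ => x
  lab := fun _ => Set.univ

/-- `GAx L d (n+1) = G^A_n`, and `GAx L d 0 = G^A_{-1}`. -/
def GAx [Nonempty V] (L : Labeling G φ a b) (d : ℕ) : ℕ → EIG V α
  | 0 => baseEIG V a d
  | n + 1 => GAeig L n

/-- `GBx L d (n+1) = G^B_n`, and `GBx L d 0 = G^B_{-1}`. -/
def GBx [Nonempty V] (L : Labeling G φ a b) (d : ℕ) : ℕ → EIG V α
  | 0 => baseEIG V b d
  | n + 1 => GBeig L n

/-- `Cx L (n+1) = C_n`, and `Cx L 0 = C_{-1}` (the class of the empty ball). -/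
def Cx (L : Labeling G φ a b) : ℕ → Set V
  | 0 => Set.univ
  | n + 1 => L.C n

/-! ## Concatenations -/

/-- The `(i)`-concatenation of two edge-indexed graphs at the end vertices `v, v'`
(which are identified). -/
def concatI (X Y : EIG V α) (v : X.Vert) (v' : Y.Vert) (i : ℕ) : EIG V α where
  Vert := X.Vert ⊕ {w : Y.Vert // w ≠ v'}
  idx := fun p q =>
    match p, q with
    | Sum.inl u, Sum.inl w =>
        if u = v ∧ w ≠ v then (if X.idx u w = 0 then 0 else i) else X.idx u w
    | Sum.inl u, Sum.inr w => if u = v then Y.idx v' w.1 - i else 0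
    | Sum.inr w, Sum.inl u => if u = v then Y.idx w.1 v' else 0
    | Sum.inr w, Sum.inr w2 => Y.idx w.1 w2.1
  col := Sum.elim X.col (fun w => Y.col w.1)
  lab := Sum.elim X.lab (fun w => Y.lab w.1)

/-- The `(i,j)`-concatenation of two edge-indexed graphs at the end vertices `v, v'`
(which stay distinct, joined by a new edge of indices `i`, `j`). -/
def concatIJ (X Y : EIG V α) (v : X.Vert) (v' : Y.Vert) (i j : ℕ) : EIG V α where
  Vert := X.Vert ⊕ Y.Vert
  idx := fun p q =>
    match p, q with
    | Sum.inl u, Sum.inl w => if u = v ∧ w = v then X.idx v v - i else X.idx u w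
    | Sum.inl u, Sum.inr w => if u = v ∧ w = v' then i else 0
    | Sum.inr w, Sum.inl u => if w = v' ∧ u = v then j else 0
    | Sum.inr u, Sum.inr w => if u = v' ∧ w = v' then Y.idx v' v' - j else Y.idx u w
  col := Sum.elim X.col Y.col
  lab := Sum.elim X.lab Y.lab

/-- `Z` is a concatenation ((i)- or (i,j)-) of `X` and `Y` at `(vX, vY)`. -/
def IsConcatOfAt (Z X Y : EIG V α) (vX : X.Vert) (vY : Y.Vert) : Prop :=
  (∃ i, 1 ≤ i ∧ Nonempty (EIGIso Z (concatI X Y vX vY i))) ∨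
  (∃ i j, 1 ≤ i ∧ 1 ≤ j ∧ Nonempty (EIGIso Z (concatIJ X Y vX vY i j)))

/-! ## Paths, distance, degree in edge-indexed graphs -/

/-- Adjacency (by an edge of positive index, in one of the two orientations). -/
def EIGAdj (X : EIG V α) (u w : X.Vert) : Prop :=
  u ≠ w ∧ (0 < X.idx u w ∨ 0 < X.idx w u)

/-- There is a path of length `L` from `u` to `w`. -/
def EIGReach (X : EIG V α) (u w : X.Vert) (L : ℕ) : Prop :=
  ∃ c : ℕ → X.Vert, c 0 = u ∧ c L = w ∧ ∀ i < L, EIGAdj X (c i) (c (i + 1))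

/-- Graph distance in an edge-indexed graph. -/
def EIGDist (X : EIG V α) (u w : X.Vert) : ℕ :=
  sInf {L | EIGReach X u w L}

/-- `u` has degree one: there is exactly one vertex adjacent to it. -/
def EIGEndVert (X : EIG V α) (u : X.Vert) : Prop :=
  ∃! w, EIGAdj X u w

/-! ## Coverings, direct limits, quotient graph, bounded type -/

/-- `p` exhibits the graph `H` as the universal cover of the edge-indexed graph `Y`:
above a vertex mapping to `u`, the number of neighbors above `w` is the index `idx u w`. -/
def IsEIGCover {W : Type} (H : SimpleGraph W) (Y : EIG V α) (p : W → Y.Vert) : Prop :=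
  ∀ x : W, ∀ u : Y.Vert, (H.neighborSet x ∩ p ⁻¹' {u}).ncard = Y.idx (p x) u

/-- `Y` is the direct limit of the system `F` of colored edge-indexed graphs along the
inclusions `ι`. -/
def IsDirLimit (F : ℕ → EIG V α) (ι : ∀ k, (F k).Vert → (F (k + 1)).Vert)
    (Y : EIG V α) : Prop :=
  ∃ j : ∀ k, (F k).Vert → Y.Vert,
    (∀ k v, j (k + 1) (ι k v) = j k v) ∧
    (∀ k, Function.Injective (j k)) ∧
    (∀ y, ∃ k v, j k v = y) ∧
    (∀ k v, Y.col (j k v) = (F k).col v) ∧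
    (∀ y z : Y.Vert, ∃ N, ∀ k, N ≤ k → ∀ v w, j k v = y → j k w = z →
      Y.idx y z = (F k).idx v w)

/-- The coloring `φ` is of bounded type: every vertex has finite type set. -/
def BoundedType (G : SimpleGraph V) (φ : V → α) : Prop :=
  ∀ v : V, {m : ℕ | IsSpecialVert G φ m v}.Finite

/-- Two vertices are related if some color-preserving automorphism maps one to the other. -/
def colorOrbitRel (G : SimpleGraph V) (φ : V → α) (x y : V) : Prop :=
  ∃ g : V ≃ V, (∀ u w, G.Adj u w ↔ G.Adj (g u) (g w)) ∧ (∀ u, φ (g u) = φ u) ∧ g x = y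

/-- The quotient graph `X_φ = G\T` as a colored edge-indexed graph. -/
def quotEIG (G : SimpleGraph V) (φ : V → α) : EIG V α where
  Vert := Quot (colorOrbitRel G φ)
  idx := fun u w => (G.neighborSet u.out ∩ {z | Quot.mk (colorOrbitRel G φ) z = w}).ncard
  col := fun u => φ u.out
  lab := fun u => {z | Quot.mk (colorOrbitRel G φ) z = u}

/-! ## The sequences `n_k`, `α_k`, `β_k` -/

/-- At level `n`, one of `A_n, B_n` is `S_n` or `C_n`. -/
def SpecTouch (L : Labeling G φ a b) (n : ℕ) : Prop :=
  L.A n = L.S n ∨ L.A n = L.C n ∨ L.B n = L.S n ∨ L.B n = L.C n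

/-- `nk` is the increasing enumeration of the levels where `SpecTouch` holds. -/
def IsNkSeq (L : Labeling G φ a b) (nk : ℕ → ℕ) : Prop :=
  StrictMono nk ∧ ∀ n, (∃ k, nk k = n) ↔ SpecTouch L n

/-- `αs` is the sequence `α_k`: `α_K = A`, and for `k ≠ K`, `α_k` is the side whose
graph `G^{α_k}_{n_k}` has more vertices. -/
def IsAlphaSeq (L : Labeling G φ a b) (nk : ℕ → ℕ) (K : ℕ∞) (αs : ℕ → Bool) : Prop :=
  ∀ k : ℕ, ((k : ℕ∞) = K → αs k = true) ∧
    ((k : ℕ∞) ≠ K → (αs k = true ↔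
      (VGside L (nk k) false).ncard < (VGside L (nk k) true).ncard))

/-- The sequence `β_k(t)`: `β_{k-1}(t)` is the letter `ᾱ_k` if the class of the
`n_k`-ball at `t` is a vertex of `G^{ᾱ_k}_{n_k}`, and `α_k` otherwise. -/
def betaOf (L : Labeling G φ a b) (nk : ℕ → ℕ) (αs : ℕ → Bool) (t : V) (k : ℕ) : Bool :=
  if ballClass G φ (nk (k + 1)) t ∈ VGside L (nk (k + 1)) (!(αs (k + 1))) then
    !(αs (k + 1))
  else αs (k + 1)

end Sturm

namespace Sturm

/-- The identities of Lemma 2.7 for the labels `(S, C, A, B)`; the index of a class is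
expressed via an arbitrary representative center, so each identity is quantified over
all representatives (in particular it contains the well-definedness of the indices).
Here `A (n+1)` (resp. `B (n+1)`), as a set of centers, is the set of representatives
of `S n` used for the index `i_A` (resp. `i_B`). -/
def IndexIdentities (G : SimpleGraph V) (φ : V → α) (S C A B : ℕ → Set V) : Prop :=
  ∀ n : ℕ, ∀ v : V, ballClass G φ n v ≠ S n →
    -- (1): for `U ≠ S_n, C_n`, `i(U,V) = i(Ū,V̄)` and
    -- `i(U,S_n) = i(Ū,A_{n+1}) + i(Ū,B_{n+1})`
    ((∀ u : V, ballClass G φ n u ≠ S n → ballClass G φ n u ≠ C n →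
        ∀ u'', BallEquiv G φ n u u'' → ∀ u', BallEquiv G φ (n + 1) u u' →
          nbrCount G u'' (ballClass G φ n v) = nbrCount G u' (ballClass G φ (n + 1) v) ∧
          nbrCount G u'' (S n) = nbrCount G u' (A (n + 1)) + nbrCount G u' (B (n + 1))) ∧
    -- (2): the case `C_n ≠ S_n`
     (C n ≠ S n →
        (∀ z ∈ C n, ∀ w ∈ A (n + 2),
          nbrCount G z (ballClass G φ n v) = nbrCount G w (ballClass G φ (n + 1) v) ∧
          nbrCount G z (S n) = nbrCount G w (A (n + 1)) + nbrCount G w (B (n + 1))) ∧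
        (∀ w ∈ A (n + 1), ∀ w' ∈ A (n + 1),
          nbrCount G w (ballClass G φ n v) = nbrCount G w' (ballClass G φ (n + 1) v) ∧
          nbrCount G w (S n) = nbrCount G w' (A (n + 1)) + nbrCount G w' (B (n + 1)))) ∧
    -- (3): the case `C_n = S_n` with `S_{n+1} = A_{n+1}`
     (C n = S n → S (n + 1) = A (n + 1) →
        (∀ x ∈ A (n + 1), ∀ w ∈ A (n + 2), ∀ w' ∈ B (n + 2),
          (nbrCount G x (ballClass G φ n v) = nbrCount G w (ballClass G φ (n + 1) v) ∧
           nbrCount G x (ballClass G φ n v) = nbrCount G w' (ballClass G φ (n + 1) v)) ∧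
          (nbrCount G x (S n) = nbrCount G w (A (n + 1)) + nbrCount G w (B (n + 1)) ∧
           nbrCount G x (S n) = nbrCount G w' (A (n + 1)) + nbrCount G w' (B (n + 1)))) ∧
        (∀ x ∈ B (n + 1), ∀ w ∈ B (n + 1),
          nbrCount G x (ballClass G φ n v) = nbrCount G w (ballClass G φ (n + 1) v) ∧
          nbrCount G x (S n) = nbrCount G w (A (n + 1)) + nbrCount G w (B (n + 1)))))

section BallMaps

variable {V α : Type} {G : SimpleGraph V} {φ : V → α}

/-- The last step of a geodesic from `u` to `z`. -/
lemma exists_adj_dist_le (hG : G.Connected) {u z : V} {j : ℕ} (hlt : j < G.dist u z)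
    (hz : G.dist u z ≤ j + 1) : ∃ w, G.Adj w z ∧ G.dist u w ≤ j := by
  obtain ⟨p, hp⟩ := hG.exists_walk_length_eq_dist z u
  rw [SimpleGraph.dist_comm] at hlt hz
  cases p with
  | nil => simp at hlt
  | @cons _ w _ h q =>
    refine ⟨w, h.symm, ?_⟩
    rw [SimpleGraph.dist_comm]
    have := SimpleGraph.dist_le q
    simp only [SimpleGraph.Walk.length_cons] at hp
    omega

/-- An adjacency-preserving map from a ball of a connected graph is 1-Lipschitz on every
concentric ball `N_j(u)` contained in its domain. -/
lemma dist_map_le (hG : G.Connected) {m : ℕ} {x y : V}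
    (f : {z : V // G.dist x z ≤ m} → {z : V // G.dist y z ≤ m})
    (hadj : ∀ u v : {z : V // G.dist x z ≤ m}, G.Adj u.1 v.1 → G.Adj (f u).1 (f v).1)
    (u : {z : V // G.dist x z ≤ m}) (j : ℕ) (hj : G.dist x u.1 + j ≤ m)
    (z : {z : V // G.dist x z ≤ m}) (hz : G.dist u.1 z.1 ≤ j) :
    G.dist (f u).1 (f z).1 ≤ j := by
  induction j generalizing z with
  | zero =>
    have : u = z := Subtype.ext (hG.dist_eq_zero_iff.1 (Nat.le_zero.1 hz))
    simp [this]
  | succ j ih =>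
    rcases Nat.lt_or_ge j (G.dist u.1 z.1) with hlt | hle
    · obtain ⟨w, h, hw⟩ := exists_adj_dist_le hG hlt hz
      have hxw : G.dist x w ≤ m := by
        have := hG.dist_triangle (u := x) (v := u.1) (w := w)
        omega
      have h1 := ih (by omega) ⟨w, hxw⟩ hw
      have h2 : G.dist (f ⟨w, hxw⟩).1 (f z).1 = 1 :=
        SimpleGraph.dist_eq_one_iff_adj.2 (hadj _ _ h)
      have := hG.dist_triangle (u := (f u).1) (v := (f ⟨w, hxw⟩).1) (w := (f z).1)
      omega
    · exact (ih (by omega) z hle).trans (Nat.le_succ j)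

lemma BallEquiv.refl (n : ℕ) (x : V) : BallEquiv G φ n x x :=
  ⟨Equiv.refl _, fun _ _ => Iff.rfl, fun _ => rfl, rfl⟩

lemma BallEquiv.symm {n : ℕ} {x y : V} (h : BallEquiv G φ n x y) : BallEquiv G φ n y x := by
  obtain ⟨f, hadj, hcol, hc⟩ := h
  refine ⟨f.symm, fun u v => ?_, fun u => ?_, ?_⟩
  · simp [hadj]
  · simp [← hcol]
  · have : f.symm ⟨y, by simp⟩ = ⟨x, by simp⟩ := by
      rw [Equiv.symm_apply_eq]
      exact Subtype.ext hc.symm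
    exact congrArg Subtype.val this

lemma BallEquiv.trans {n : ℕ} {x y z : V} (h : BallEquiv G φ n x y)
    (h' : BallEquiv G φ n y z) : BallEquiv G φ n x z := by
  obtain ⟨f, hadj, hcol, hc⟩ := h
  obtain ⟨g, hadj', hcol', hc'⟩ := h'
  refine ⟨f.trans g, fun u v => ?_, fun u => ?_, ?_⟩
  · simp [hadj, hadj']
  · simp [hcol, hcol']
  · have : f ⟨x, by simp⟩ = ⟨y, by simp⟩ := Subtype.ext hc
    simp only [Equiv.trans_apply, this]
    exact hc'

/-- An isomorphism of `m`-balls restricts to every ball `N_k(u)` inside its domain. -/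
lemma ballEquiv_restrict (hG : G.Connected) {m : ℕ} {x y : V}
    (f : {z : V // G.dist x z ≤ m} ≃ {z : V // G.dist y z ≤ m})
    (hadj : ∀ u v : {z : V // G.dist x z ≤ m}, G.Adj u.1 v.1 ↔ G.Adj (f u).1 (f v).1)
    (hcol : ∀ u : {z : V // G.dist x z ≤ m}, φ (f u).1 = φ u.1)
    (hc : (f ⟨x, by simp⟩).1 = y)
    (u : {z : V // G.dist x z ≤ m}) {k : ℕ} (hk : G.dist x u.1 + k ≤ m) :
    BallEquiv G φ k u.1 (f u).1 := by
  have hadj' : ∀ u v : {z : V // G.dist y z ≤ m},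
      G.Adj u.1 v.1 → G.Adj (f.symm u).1 (f.symm v).1 := fun u v h => by
    simpa [hadj] using h
  have hfu : G.dist y (f u).1 ≤ G.dist x u.1 := by
    have := dist_map_le hG f (fun u v => (hadj u v).1) ⟨x, by simp⟩ (G.dist x u.1)
      (by simpa using u.2) u le_rfl
    rwa [hc] at this
  have hmem : ∀ z, G.dist u.1 z ≤ k → G.dist x z ≤ m := fun z hz => by
    have := hG.dist_triangle (u := x) (v := u.1) (w := z)
    omega
  have hmem' : ∀ z, G.dist (f u).1 z ≤ k → G.dist y z ≤ m := fun z hz => by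
    have := hG.dist_triangle (u := y) (v := (f u).1) (w := z)
    omega
  refine ⟨{
    toFun := fun z => ⟨(f ⟨z.1, hmem _ z.2⟩).1,
      dist_map_le hG f (fun u v => (hadj u v).1) u k hk _ z.2⟩
    invFun := fun z => ⟨(f.symm ⟨z.1, hmem' _ z.2⟩).1, by
      simpa using dist_map_le hG f.symm hadj' (f u) k (by omega) ⟨z.1, hmem' _ z.2⟩ z.2⟩
    left_inv := fun z => by simp
    right_inv := fun z => by simp }, fun v w => ?_, fun v => ?_, rfl⟩
  · exact hadj ⟨v.1, hmem _ v.2⟩ ⟨w.1, hmem _ w.2⟩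
  · exact hcol ⟨v.1, hmem _ v.2⟩

lemma BallEquiv.of_succ (hG : G.Connected) {n : ℕ} {x y : V}
    (h : BallEquiv G φ (n + 1) x y) : BallEquiv G φ n x y := by
  obtain ⟨f, hadj, hcol, hc⟩ := h
  have := ballEquiv_restrict hG f hadj hcol hc ⟨x, by simp⟩ (k := n) (by simp)
  rwa [hc] at this

/-- Centers of equivalent `(n+1)`-balls have the same number of neighbors in any set of
vertices that is a union of classes of `n`-balls. -/
lemma nbrCount_congr (hG : G.Connected) {n : ℕ} {x y : V} (h : BallEquiv G φ (n + 1) x y)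
    {E : Set V} (hE : ∀ u v, BallEquiv G φ n u v → (u ∈ E ↔ v ∈ E)) :
    nbrCount G x E = nbrCount G y E := by
  obtain ⟨f, hadj, hcol, hc⟩ := h
  have hmem : ∀ {p q : V}, G.Adj p q → G.dist p q ≤ n + 1 := fun h => by
    rw [SimpleGraph.dist_eq_one_iff_adj.2 h]
    omega
  have hx : f ⟨x, by simp⟩ = ⟨y, by simp⟩ := Subtype.ext hc
  have hres : ∀ u, G.Adj x u.1 → BallEquiv G φ n u.1 (f u).1 := fun u hu =>
    ballEquiv_restrict hG f hadj hcol hc u (by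
      rw [SimpleGraph.dist_eq_one_iff_adj.2 hu]
      omega)
  refine Set.ncard_congr (fun u hu => (f ⟨u, hmem hu.1⟩).1) ?_ ?_ ?_
  · rintro u ⟨hu, hu'⟩
    refine ⟨?_, (hE _ _ (hres ⟨u, hmem hu⟩ hu)).1 hu'⟩
    have := (hadj ⟨x, by simp⟩ ⟨u, hmem hu⟩).1 hu
    rwa [hx] at this
  · intro u v hu hv huv
    simpa using congrArg Subtype.val (f.injective (Subtype.ext huv))
  · rintro v ⟨hv, hv'⟩
    have hadj' : G.Adj x (f.symm ⟨v, hmem hv⟩).1 := by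
      refine (hadj ⟨x, by simp⟩ _).2 ?_
      rw [hx]
      simpa using hv
    have hv'' := hres _ hadj'
    rw [Equiv.apply_symm_apply] at hv''
    exact ⟨_, ⟨hadj', (hE _ _ hv'').2 hv'⟩, by simp⟩

lemma mem_ballClass {n : ℕ} {x y : V} : y ∈ ballClass G φ n x ↔ BallEquiv G φ n x y := Iff.rfl

lemma ballClass_eq_iff {n : ℕ} {x y : V} :
    ballClass G φ n x = ballClass G φ n y ↔ BallEquiv G φ n x y := by
  refine ⟨fun h => ?_, fun h => Set.ext fun z => ⟨h.symm.trans, h.trans⟩⟩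
  rw [← mem_ballClass, h]
  exact .refl n y

end BallMaps

section Special

variable {V α : Type} {G : SimpleGraph V} {φ : V → α}

/-- A map onto a set with one element less identifies only one pair of points. -/
lemma eq_and_eq_of_ncard_eq_succ {β γ : Type*} {s : Set β} {t : Set γ} {r : β → γ}
    (hs : s.ncard = t.ncard + 1) (hst : r '' s = t) {p q x y : β}
    (hp : p ∈ s) (hq : q ∈ s) (hpq : p ≠ q) (hrpq : r p = r q)
    (hx : x ∈ s) (hy : y ∈ s) (hxy : x ≠ y) (hrxy : r x = r y) :
    (x = p ∧ y = q) ∨ (x = q ∧ y = p) := by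
  have hsf : s.Finite := Set.finite_of_ncard_pos (by omega)
  have key : ∀ p ∈ s, ∀ q ∈ s, p ≠ q → r p = r q → Set.InjOn r (s \ {p}) := by
    intro p hp q hq hpq hr
    refine Set.injOn_of_ncard_image_eq ?_ hsf.sdiff
    have himage : r '' (s \ {p}) = t := by
      rw [← hst]
      refine (Set.image_mono Set.sdiff_subset).antisymm ?_
      rintro _ ⟨z, hz, rfl⟩
      by_cases hzp : z = p
      · exact ⟨q, ⟨hq, hpq.symm⟩, by rw [hzp, hr]⟩
      · exact ⟨z, ⟨hz, hzp⟩, rfl⟩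
    rw [himage, Set.ncard_sdiff_singleton_of_mem hp]
    omega
  have h1 : x = p ∨ y = p := by
    by_contra! h
    exact hxy (key p hp q hq hpq hrpq ⟨hx, h.1⟩ ⟨hy, h.2⟩ hrxy)
  have h2 : x = q ∨ y = q := by
    by_contra! h
    exact hxy (key q hq p hp hpq.symm hrpq.symm ⟨hx, h.1⟩ ⟨hy, h.2⟩ hrxy)
  rcases h1 with rfl | rfl
  · exact Or.inl ⟨rfl, h2.resolve_left hpq⟩
  · exact Or.inr ⟨h2.resolve_right hpq, rfl⟩

/-- For a Sturmian coloring, all pairs of inequivalent `(n+1)`-balls with equivalent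
central `n`-balls have the same pair of classes. -/
lemma IsSturmian.special_pair (hG : G.Connected) (hSt : IsSturmian G φ) {n : ℕ}
    {p q x y : V} (hpq : BallEquiv G φ n p q) (hpq' : ¬ BallEquiv G φ (n + 1) p q)
    (hxy : BallEquiv G φ n x y) (hxy' : ¬ BallEquiv G φ (n + 1) x y) :
    (BallEquiv G φ (n + 1) x p ∧ BallEquiv G φ (n + 1) y q) ∨
      (BallEquiv G φ (n + 1) x q ∧ BallEquiv G φ (n + 1) y p) := by
  let r : Set V → Set V := fun X => {z | ∃ w ∈ X, BallEquiv G φ n w z}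
  have hr : ∀ u, r (ballClass G φ (n + 1) u) = ballClass G φ n u := fun u => by
    ext z
    exact ⟨fun ⟨w, hw, hwz⟩ => (BallEquiv.of_succ hG hw).trans hwz,
      fun hz => ⟨u, .refl _ u, hz⟩⟩
  have himage : r '' ballClasses G φ (n + 1) = ballClasses G φ n := by
    ext X
    constructor
    · rintro ⟨_, ⟨u, rfl⟩, rfl⟩
      exact ⟨u, hr u⟩
    · rintro ⟨u, rfl⟩
      exact ⟨_, ⟨u, rfl⟩, hr u⟩
  have hn := hSt n
  have hn' := hSt (n + 1)
  simp only [← ballClass_eq_iff] at hpq hpq' hxy hxy' ⊢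
  exact eq_and_eq_of_ncard_eq_succ (r := r) (by omega) himage ⟨p, rfl⟩ ⟨q, rfl⟩ hpq'
    (by rw [hr, hr, hpq]) ⟨x, rfl⟩ ⟨y, rfl⟩ hxy' (by rw [hr, hr, hxy])

/-- The index identities hold for any sequences of classes such that `S_n` is the only
special class of `n`-balls, with extensions `A_{n+1}` and `B_{n+1}`. -/
lemma indexIdentities_of_extensions (hG : G.Connected)
    (hfin : ∀ x : V, (G.neighborSet x).Finite) {S C A B : ℕ → Set V}
    (hC : ∀ n, ∃ x, S (n + 1) = ballClass G φ (n + 1) x ∧ C n = ballClass G φ n x)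
    (hS : ∀ n, ∃ x, S n = ballClass G φ n x)
    (hA : ∀ n, ∃ x, A (n + 1) = ballClass G φ (n + 1) x)
    (hB : ∀ n, ∃ x, B (n + 1) = ballClass G φ (n + 1) x)
    (hunion : ∀ n, S n = A (n + 1) ∪ B (n + 1))
    (hdisj : ∀ n, Disjoint (A (n + 1)) (B (n + 1)))
    (hext : ∀ n x y, x ∉ S n → BallEquiv G φ n x y → BallEquiv G φ (n + 1) x y) :
    IndexIdentities G φ S C A B := by
  have hclass : ∀ n v x y, BallEquiv G φ n x y →
      (x ∈ ballClass G φ n v ↔ y ∈ ballClass G φ n v) := fun n v x y h =>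
    ⟨fun hx => BallEquiv.trans hx h, fun hy => BallEquiv.trans hy h.symm⟩
  have hnot : ∀ n v, ballClass G φ n v ≠ S n → v ∉ S n := fun n v hv hvS => by
    obtain ⟨x, hx⟩ := hS n
    rw [hx, mem_ballClass, ← ballClass_eq_iff] at hvS
    exact hv (hvS.symm.trans hx.symm)
  have hsub : ∀ {n}, A (n + 1) ⊆ S n ∧ B (n + 1) ⊆ S n := fun {n} => by
    simp [hunion n]
  have hrel : ∀ n {X : Set V}, (∃ x, X = ballClass G φ n x) → ∀ y ∈ X, ∀ z ∈ X,
      BallEquiv G φ n y z := by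
    rintro n X ⟨x, rfl⟩ y hy z hz
    exact BallEquiv.trans (BallEquiv.symm hy) hz
  intro n v hv
  have key : ∀ x y, BallEquiv G φ (n + 1) x y →
      nbrCount G x (ballClass G φ n v) = nbrCount G y (ballClass G φ (n + 1) v) ∧
      nbrCount G x (S n) = nbrCount G y (A (n + 1)) + nbrCount G y (B (n + 1)) := by
    intro x y hxy
    constructor
    · have : ballClass G φ (n + 1) v = ballClass G φ n v :=
        Set.ext fun z => ⟨BallEquiv.of_succ hG, hext n v z (hnot n v hv)⟩
      rw [this]
      exact nbrCount_congr hG hxy (hclass n v)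
    · obtain ⟨s, hs⟩ := hS n
      rw [nbrCount_congr hG hxy (hs ▸ hclass n s), hunion n]
      simp only [nbrCount, Set.inter_union_distrib_left]
      exact Set.ncard_union_eq ((hdisj n).mono Set.inter_subset_right Set.inter_subset_right)
        ((hfin y).inter_of_left _) ((hfin y).inter_of_left _)
  refine ⟨fun u hu _ u'' hu'' u' hu' => key _ _ ?_,
    fun hCS => ⟨fun z hz w hw => key _ _ ?_, fun w hw w' hw' => key _ _ ?_⟩,
    fun _ hSA => ⟨fun x hx w hw w' hw' => ?_, fun x hx w hw => key _ _ ?_⟩⟩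
  · exact (hext n u u'' (hnot n u hu) hu'').symm.trans hu'
  · obtain ⟨x, hx, hx'⟩ := hC n
    rw [hx'] at hCS hz
    have hxw : w ∈ ballClass G φ (n + 1) x := hx ▸ hsub.1 hw
    exact (hext n x z (hnot n x hCS) hz).symm.trans hxw
  · exact hrel _ (hA n) w hw w' hw'
  · have h1 := key x w (hrel _ (hA n) x hx w (hSA ▸ hsub.1 hw))
    have h2 := key x w' (hrel _ (hA n) x hx w' (hSA ▸ hsub.2 hw'))
    exact ⟨⟨h1.1, h2.1⟩, h1.2, h2.2⟩
  · exact hrel _ (hB n) x hx w hw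

end Special

/-- Lemma 2.7: the index identities relating levels `n` and `n + 1`,
together with the analogous identities with the roles of `A` and `B` exchanged. -/
theorem index_identities {V α : Type} (G : SimpleGraph V) (d : ℕ) (hd : 3 ≤ d)
    (hT : IsRegularTree G d) (φ : V → α) (hSt : IsSturmian G φ)
    (a b : α) (hab : a ≠ b) (L : Labeling G φ a b) :
    IndexIdentities G φ L.S L.C L.A L.B ∧ IndexIdentities G φ L.S L.C L.B L.A := by
  have hG : G.Connected := hT.isTree.connected
  have hfin : ∀ x : V, (G.neighborSet x).Finite := fun x =>
    Set.finite_of_ncard_pos (by rw [hT.regular x]; omega)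
  have hS : ∀ n, ∃ x, L.S n = ballClass G φ n x := fun n =>
    (L.S_special n).imp fun _ h => h.1
  have hC : ∀ n, ∃ x, L.S (n + 1) = ballClass G φ (n + 1) x ∧ L.C n = ballClass G φ n x :=
    fun n => (L.C_central n).imp fun _ h => h.2
  have hA : ∀ n, ∃ x, L.A (n + 1) = ballClass G φ (n + 1) x := fun n =>
    (L.A_ext n).imp fun _ h => h.2.2
  have hB : ∀ n, ∃ x, L.B (n + 1) = ballClass G φ (n + 1) x := fun n =>
    (L.B_ext n).imp fun _ h => h.2.2
  have hAB : ∀ n, ∃ p q, L.S n = ballClass G φ n p ∧ BallEquiv G φ n p q ∧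
      ¬ BallEquiv G φ (n + 1) p q ∧ L.A (n + 1) = ballClass G φ (n + 1) p ∧
      L.B (n + 1) = ballClass G φ (n + 1) q := fun n => by
    obtain ⟨p, -, hp, hp'⟩ := L.A_ext n
    obtain ⟨q, -, hq, hq'⟩ := L.B_ext n
    refine ⟨p, q, hp, ballClass_eq_iff.1 (hp.symm.trans hq), fun h => L.AB_ne n ?_, hp', hq'⟩
    rw [hp', hq', ballClass_eq_iff.2 h]
  have hunion : ∀ n, L.S n = L.A (n + 1) ∪ L.B (n + 1) := fun n => by
    obtain ⟨p, q, hSp, hpq, hpq', hAp, hBq⟩ := hAB n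
    rw [hSp, hAp, hBq]
    ext z
    refine ⟨fun hz => ?_, fun hz => hz.elim (BallEquiv.of_succ hG)
      fun h => hpq.trans (BallEquiv.of_succ hG h)⟩
    by_cases hpz : BallEquiv G φ (n + 1) p z
    · exact Or.inl hpz
    · rcases hSt.special_pair hG hpq hpq' hz hpz with h | h
      · exact Or.inr h.2.symm
      · exact absurd h.1 hpq'
  have hdisj : ∀ n, Disjoint (L.A (n + 1)) (L.B (n + 1)) := fun n => by
    obtain ⟨p, q, -, -, hpq', hAp, hBq⟩ := hAB n
    rw [hAp, hBq, Set.disjoint_left]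
    exact fun z hp hq => hpq' (BallEquiv.trans hp (BallEquiv.symm hq))
  have hext : ∀ n x y, x ∉ L.S n → BallEquiv G φ n x y → BallEquiv G φ (n + 1) x y := by
    intro n x y hx hxy
    obtain ⟨p, q, hSp, hpq, hpq', -, -⟩ := hAB n
    by_contra hxy'
    refine hx (hSp ▸ ?_)
    rcases hSt.special_pair hG hpq hpq' hxy hxy' with h | h
    · exact BallEquiv.symm (.of_succ hG h.1)
    · exact hpq.trans (BallEquiv.symm (.of_succ hG h.1))
  exact ⟨indexIdentities_of_extensions hG hfin hC hS hA hB hunion hdisj hext,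
    indexIdentities_of_extensions hG hfin hC hS hB hA
      (fun n => (hunion n).trans (Set.union_comm _ _)) (fun n => (hdisj n).symm) hext⟩

end Sturm
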